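/- The expected value of the reciprocal of the stopping time τ equals π/2 − 1: E[1/τ] = π/2 − 1. -/

import Mathlib

open MeasureTheory ProbabilityTheory Real

open scoped Classical in
/-- The walk weight, killed when the walk has reached level one. -/
noncomputable def killedF (s r : ℝ) (n : ℕ) (x : ℕ → ℤ) : ℝ :=
  if ∀ k, 1 ≤ k → k ≤ n → ∑ i ∈ Finset.range k, x i ≠ 1 then
    s ^ n * r ^ (-∑ i ∈ Finset.range n, x i) else 0

lemma killedF_congr (s r : ℝ) (n : ℕ) (x y : ℕ → ℤ) (h : ∀ i < n, x i = y i) :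
    killedF s r n x = killedF s r n y := by
  have hs : ∀ k ≤ n, ∑ i ∈ Finset.range k, x i = ∑ i ∈ Finset.range k, y i := fun k hk =>
    Finset.sum_congr rfl fun i hi => h i (by have := Finset.mem_range.1 hi; omega)
  unfold killedF
  rw [hs n le_rfl]
  have : (∀ k, 1 ≤ k → k ≤ n → ∑ i ∈ Finset.range k, x i ≠ 1) ↔
      (∀ k, 1 ≤ k → k ≤ n → ∑ i ∈ Finset.range k, y i ≠ 1) :=
    forall_congr' fun k => forall_congr' fun _ => forall_congr' fun hk => by rw [hs k hk]
  by_cases hy : ∀ k, 1 ≤ k → k ≤ n → ∑ i ∈ Finset.range k, y i ≠ 1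
  · rw [if_pos hy, if_pos (this.2 hy)]
  · rw [if_neg hy, if_neg (fun h => hy (this.1 h))]

section
variable {Ω : Type*} [MeasurableSpace Ω] (P : Measure Ω) [IsProbabilityMeasure P]
    (X : ℕ → Ω → ℤ)

lemma killedF_factor (s r : ℝ) (n : ℕ) : ∃ φ : ((Finset.range n) → ℤ) → ℝ,
    ∀ ω, killedF s r n (fun i => X i ω) = φ (fun i => X i ω) := by
  refine ⟨fun x => killedF s r n (fun i => if h : i ∈ Finset.range n then x ⟨i, h⟩ else 0), ?_⟩
  intro ω
  apply killedF_congr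
  intro i hi
  simp [hi]

lemma killedF_meas (hmeas : ∀ i, Measurable (X i)) (s r : ℝ) (n : ℕ) :
    Measurable (fun ω => killedF s r n (fun i => X i ω)) := by
  obtain ⟨φ, hφ⟩ := killedF_factor X s r n
  simp only [hφ]
  exact (measurable_of_countable φ).comp (measurable_pi_lambda _ fun i => hmeas i)

lemma X_ae (hmeas : ∀ i, Measurable (X i))
    (hheads : ∀ i, P {ω | X i ω = 1} = 1/2)
    (htails : ∀ i, P {ω | X i ω = -1} = 1/2) : ∀ᵐ ω ∂P, ∀ i, X i ω = 1 ∨ X i ω = -1 := by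
  rw [ae_all_iff]
  intro i
  have m1 : MeasurableSet {ω | X i ω = 1} := hmeas i (measurableSet_singleton 1)
  have m2 : MeasurableSet {ω | X i ω = -1} := hmeas i (measurableSet_singleton (-1))
  have h : P ({ω | X i ω = 1} ∪ {ω | X i ω = -1}) = 1 := by
    rw [measure_union _ m2, hheads, htails, ENNReal.add_halves]
    rw [Set.disjoint_left]
    intro ω h1 h2
    simp only [Set.mem_setOf_eq] at h1 h2
    omega
  exact (prob_compl_eq_zero_iff (m1.union m2)).2 h

lemma int_zpow (hmeas : ∀ i, Measurable (X i))
    (hheads : ∀ i, P {ω | X i ω = 1} = 1/2)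
    (htails : ∀ i, P {ω | X i ω = -1} = 1/2) (r : ℝ) (n : ℕ) :
    Integrable (fun ω => r ^ (-X n ω)) P ∧ ∫ ω, r ^ (-X n ω) ∂P = (r + r⁻¹) / 2 := by
  have m1 : MeasurableSet {ω | X n ω = 1} := hmeas n (measurableSet_singleton 1)
  have m2 : MeasurableSet {ω | X n ω = -1} := hmeas n (measurableSet_singleton (-1))
  have hae : (fun ω => r ^ (-X n ω)) =ᵐ[P] fun ω =>
      {ω | X n ω = 1}.indicator (fun _ => r⁻¹) ω + {ω | X n ω = -1}.indicator (fun _ => r) ω := by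
    filter_upwards [X_ae P X hmeas hheads htails] with ω hω
    rcases hω n with h | h <;> simp [Set.indicator, h]
  have i1 : Integrable (fun ω => {ω | X n ω = 1}.indicator (fun _ => r⁻¹) ω) P :=
    (integrable_const r⁻¹).indicator m1
  have i2 : Integrable (fun ω => {ω | X n ω = -1}.indicator (fun _ => r) ω) P :=
    (integrable_const r).indicator m2
  refine ⟨(i1.add i2).congr hae.symm, ?_⟩
  rw [integral_congr_ae hae, integral_add i1 i2, integral_indicator_const _ m1,
    integral_indicator_const _ m2]
  simp only [measureReal_def, hheads, htails]
  simp
  ring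

lemma walk_le (x : ℕ → ℤ) (hx : ∀ i, x i = 1 ∨ x i = -1) (n : ℕ)
    (h : ∀ k, 1 ≤ k → k ≤ n → ∑ i ∈ Finset.range k, x i ≠ 1) :
    ∑ i ∈ Finset.range n, x i ≤ 0 := by
  induction n with
  | zero => simp
  | succ n ih =>
    have h1 := ih fun k a b => h k a (by omega)
    have h2 := h (n+1) (by omega) le_rfl
    rw [Finset.sum_range_succ] at h2 ⊢
    rcases hx n with h | h <;> omega

lemma killedF_bound (s r : ℝ) (hs : 0 < s) (hr : 0 < r) (hr1 : r ≤ 1) (n : ℕ)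
    (x : ℕ → ℤ) (hx : ∀ i, x i = 1 ∨ x i = -1) :
    0 ≤ killedF s r n x ∧ killedF s r n x ≤ s ^ n := by
  unfold killedF
  split_ifs with h
  · refine ⟨by positivity, ?_⟩
    have h0 := walk_le x hx n h
    have : r ^ (-∑ i ∈ Finset.range n, x i) ≤ 1 := by
      obtain ⟨m, hm⟩ := Int.eq_ofNat_of_zero_le (a := -∑ i ∈ Finset.range n, x i) (by omega)
      rw [hm]
      simpa using pow_le_one₀ hr.le hr1
    have h2 : 0 < s ^ n := by positivity
    nlinarith
  · exact ⟨le_rfl, by positivity⟩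

lemma surv_iff (τ : Ω → ℕ)
    (hτ : ∀ ω, τ ω = sInf {n | 1 ≤ n ∧ (∑ i ∈ Finset.range n, X i ω) = 1}) (n : ℕ) (ω : Ω) :
    (∀ k, 1 ≤ k → k ≤ n → ∑ i ∈ Finset.range k, X i ω ≠ 1) ↔ (τ ω = 0 ∨ n < τ ω) := by
  rw [hτ]
  set A := {n | 1 ≤ n ∧ (∑ i ∈ Finset.range n, X i ω) = 1} with hA
  constructor
  · intro h
    rcases A.eq_empty_or_nonempty with h0 | h0
    · left; simp [h0]
    · right
      by_contra hc
      have := Nat.sInf_mem h0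
      exact h _ this.1 (by omega) this.2
  · intro h k h1 h2 h3
    have hk : k ∈ A := ⟨h1, h3⟩
    have := Nat.sInf_le hk
    have h4 := (Nat.sInf_mem ⟨k, hk⟩).1
    omega

lemma hit_val (τ : Ω → ℕ)
    (hτ : ∀ ω, τ ω = sInf {n | 1 ≤ n ∧ (∑ i ∈ Finset.range n, X i ω) = 1}) (ω : Ω)
    (h : τ ω ≠ 0) : ∑ i ∈ Finset.range (τ ω), X i ω = 1 := by
  rw [hτ] at h ⊢
  have := Nat.sInf_mem (Nat.nonempty_of_pos_sInf (Nat.pos_of_ne_zero h))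
  exact this.2

lemma tau_meas (hmeas : ∀ i, Measurable (X i)) (τ : Ω → ℕ)
    (hτ : ∀ ω, τ ω = sInf {n | 1 ≤ n ∧ (∑ i ∈ Finset.range n, X i ω) = 1}) :
    Measurable τ := by
  have hA : ∀ n, MeasurableSet {ω | τ ω = 0 ∨ n < τ ω} := by
    intro n
    simp only [← surv_iff X τ hτ]
    have hS : ∀ k, MeasurableSet {ω | ∑ i ∈ Finset.range k, X i ω ≠ 1} := fun k =>
      ((Finset.measurable_sum (Finset.range k) fun i _ => hmeas i)
        (measurableSet_singleton (1:ℤ))).compl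
    simp only [Set.setOf_forall]
    exact .iInter fun k => .iInter fun _ => .iInter fun _ => hS k
  refine measurable_to_countable' fun n => ?_
  cases n with
  | zero =>
    have : τ ⁻¹' {0} = ⋂ n, {ω | τ ω = 0 ∨ n < τ ω} := by
      ext ω
      simp only [Set.mem_preimage, Set.mem_singleton_iff, Set.mem_iInter, Set.mem_setOf_eq]
      exact ⟨fun h _ => .inl h, fun h => by have := h (τ ω); omega⟩
    rw [this]
    exact .iInter hA
  | succ n =>
    have : τ ⁻¹' {n+1} = {ω | τ ω = 0 ∨ n < τ ω} \ {ω | τ ω = 0 ∨ n + 1 < τ ω} := by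
      ext ω
      simp only [Set.mem_preimage, Set.mem_singleton_iff, Set.mem_diff, Set.mem_setOf_eq]
      omega
    rw [this]
    exact (hA n).diff (hA (n+1))

lemma gen_fun (hmeas : ∀ i, Measurable (X i))
    (hindep : iIndepFun X P)
    (hheads : ∀ i, P {ω | X i ω = 1} = 1/2)
    (htails : ∀ i, P {ω | X i ω = -1} = 1/2)
    (τ : Ω → ℕ) (hτ : ∀ ω, τ ω = sInf {n | 1 ≤ n ∧ (∑ i ∈ Finset.range n, X i ω) = 1})
    (s r : ℝ) (hs : 0 < s) (hs1 : s < 1) (hr : 0 < r) (hr1 : r ≤ 1)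
    (hsr : s * ((r + r⁻¹) / 2) = 1) :
    ∫ ω, (if τ ω = 0 then 0 else s ^ (τ ω)) ∂P = r := by
  have τm := tau_meas X hmeas τ hτ
  have hX := X_ae P X hmeas hheads htails
  set K : ℕ → Ω → ℝ := fun n ω => killedF s r n (fun i => X i ω) with hK
  have Km : ∀ n, Measurable (K n) := fun n => killedF_meas X hmeas s r n
  have Kb : ∀ n, ∀ᵐ ω ∂P, 0 ≤ K n ω ∧ K n ω ≤ s ^ n := fun n => by
    filter_upwards [hX] with ω hω using killedF_bound s r hs hr hr1 n _ hω
  have sle : ∀ n, s ^ n ≤ 1 := fun n => pow_le_one₀ hs.le hs1.le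
  have Ki : ∀ n, Integrable (K n) P := fun n => by
    refine Integrable.of_bound (Km n).aestronglyMeasurable 1 ?_
    filter_upwards [Kb n] with ω h
    rw [Real.norm_eq_abs, abs_of_nonneg h.1]
    exact h.2.trans (sle n)
  set H : ℕ → Ω → ℝ := fun n ω => if τ ω = 0 ∨ n < τ ω then 0 else r⁻¹ * s ^ (τ ω) with hH
  have Hm : ∀ n, Measurable (H n) := fun n =>
    (measurable_of_countable (fun t : ℕ => if t = 0 ∨ n < t then (0:ℝ) else r⁻¹ * s ^ t)).comp τm
  have Hb : ∀ n ω, 0 ≤ H n ω ∧ H n ω ≤ r⁻¹ := fun n ω => by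
    simp only [hH]
    have := hr.le
    split_ifs
    · exact ⟨le_rfl, by positivity⟩
    · exact ⟨by positivity, mul_le_of_le_one_right (by positivity) (sle _)⟩
  have Hi : ∀ n, Integrable (H n) P := fun n => by
    refine Integrable.of_bound (Hm n).aestronglyMeasurable r⁻¹ ?_
    filter_upwards with ω
    rw [Real.norm_eq_abs, abs_of_nonneg (Hb n ω).1]
    exact (Hb n ω).2
  have Keq : ∀ n ω, K n ω = if τ ω = 0 ∨ n < τ ω then
      s ^ n * r ^ (-∑ i ∈ Finset.range n, X i ω) else 0 := by
    intro n ω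
    simp only [hK, killedF, surv_iff X τ hτ]
  -- one step identity
  have step : ∀ n ω, K (n+1) ω + H (n+1) ω = H n ω + s * (K n ω * r ^ (-X n ω)) := by
    intro n ω
    simp only [Keq, hH]
    by_cases h1 : τ ω = 0 ∨ n < τ ω
    · by_cases h2 : τ ω = 0 ∨ n + 1 < τ ω
      · simp only [h1, h2, if_true]
        rw [Finset.sum_range_succ, neg_add, zpow_add₀ hr.ne']
        ring
      · have h3 : τ ω = n + 1 := by omega
        have h4 := hit_val X τ hτ ω (by omega)
        rw [h3, Finset.sum_range_succ] at h4
        simp only [h1, h2, if_true, if_false]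
        rw [mul_assoc, ← zpow_add₀ hr.ne', ← neg_add, h4, h3]
        simp
        ring
    · have h2 : ¬ (τ ω = 0 ∨ n + 1 < τ ω) := by omega
      simp only [h1, h2, if_false]
      ring
  have hmul : ∀ n, Integrable (fun ω => K n ω * r ^ (-X n ω)) P ∧
      ∫ ω, K n ω * r ^ (-X n ω) ∂P = (∫ ω, K n ω ∂P) * ((r + r⁻¹) / 2) := by
    intro n
    obtain ⟨i2, e2⟩ := int_zpow P X hmeas hheads htails r n
    have ind : IndepFun (K n) (fun ω => r ^ (-X n ω)) P := by
      obtain ⟨φ, hφ⟩ := killedF_factor X s r n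
      have h0 := hindep.indepFun_finset (Finset.range n) {n} (by simp) hmeas
      have h1 := h0.comp (φ := φ) (ψ := fun x : (({n} : Finset ℕ) → ℤ) => r ^ (-x ⟨n, by simp⟩))
        (measurable_of_countable _) (measurable_of_countable _)
      have e : K n = φ ∘ (fun a (i : Finset.range n) => X i a) := funext hφ
      rw [e]
      exact h1
    refine ⟨ind.integrable_mul (Ki n) i2, ?_⟩
    rw [← e2]
    exact ind.integral_mul_eq_mul_integral (Ki n).aestronglyMeasurable i2.aestronglyMeasurable
  have const : ∀ n, ∫ ω, (K n ω + H n ω) ∂P = 1 := by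
    intro n
    induction n with
    | zero =>
      have : ∀ ω, K 0 ω + H 0 ω = 1 := by
        intro ω
        have : τ ω = 0 ∨ 0 < τ ω := by omega
        simp [Keq, hH, this]
      simp [this]
    | succ n ih =>
      simp only [step]
      rw [integral_add (Hi n) ((hmul n).1.const_mul s), integral_const_mul, (hmul n).2]
      rw [integral_add (Ki n) (Hi n)] at ih
      linear_combination ih + (∫ ω, K n ω ∂P) * hsr
  have lim : Filter.Tendsto (fun n => ∫ ω, (K n ω + H n ω) ∂P) Filter.atTop
      (nhds (∫ ω, r⁻¹ * (if τ ω = 0 then 0 else s ^ (τ ω)) ∂P)) := by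
    refine tendsto_integral_of_dominated_convergence (fun _ => 1 + r⁻¹)
      (fun n => ((Km n).add (Hm n)).aestronglyMeasurable) (integrable_const _) ?_ ?_
    · intro n
      filter_upwards [Kb n] with ω h
      have h' := Hb n ω
      rw [Real.norm_eq_abs, abs_of_nonneg (add_nonneg h.1 h'.1)]
      linarith [sle n]
    · filter_upwards [ae_all_iff.2 Kb] with ω h
      have l1 : Filter.Tendsto (fun n => K n ω) Filter.atTop (nhds 0) :=
        squeeze_zero (fun n => (h n).1) (fun n => (h n).2)
          (tendsto_pow_atTop_nhds_zero_of_lt_one hs.le hs1)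
      have l2 : Filter.Tendsto (fun n => H n ω) Filter.atTop
          (nhds (r⁻¹ * (if τ ω = 0 then 0 else s ^ (τ ω)))) := by
        refine tendsto_const_nhds.congr' ?_
        filter_upwards [Filter.eventually_ge_atTop (τ ω)] with n hn
        simp only [hH]
        by_cases h0 : τ ω = 0
        · simp [h0]
        · have : ¬ (τ ω = 0 ∨ n < τ ω) := by omega
          rw [if_neg this, if_neg h0]
      simpa using l1.add l2
  simp only [const] at lim
  have := tendsto_nhds_unique lim tendsto_const_nhds
  rw [integral_const_mul] at this
  field_simp at this
  exact this
end

lemma final_int : ∫ s in (0:ℝ)..1, 1 / (1 + √(1 - s^2)) = π / 2 - 1 := by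
  have hpos : ∀ s : ℝ, 1 + √(1 - s^2) ≠ 0 := fun s => by positivity
  have hc : Continuous fun s : ℝ => 1 + √(1 - s^2) := by fun_prop
  have := intervalIntegral.integral_eq_sub_of_hasDerivAt_of_le (a := 0) (b := 1)
    (f := fun s => arcsin s - s / (1 + √(1 - s^2))) (f' := fun s => 1 / (1 + √(1 - s^2)))
    zero_le_one
    (continuous_arcsin.sub (continuous_id.div hc hpos)).continuousOn ?_
    ((continuous_const.div hc hpos).intervalIntegrable _ _)
  · rw [this]; simp
  · intro s hs
    have h1 : 0 < 1 - s^2 := by nlinarith [hs.1, hs.2]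
    have d1 := hasDerivAt_arcsin (x := s) (by linarith [hs.1]) (by linarith [hs.2])
    have d2 : HasDerivAt (fun s : ℝ => 1 - s^2) (-(2 * s)) s := by
      simpa using ((hasDerivAt_id s).pow 2).const_sub 1
    have d3 := (d2.sqrt h1.ne').const_add 1
    have d4 := d1.sub ((hasDerivAt_id s).div d3 (hpos s))
    refine d4.congr_deriv ?_
    have hq : 0 < √(1 - s^2) := Real.sqrt_pos.2 h1
    have hsq : √(1 - s^2)^2 = 1 - s^2 := Real.sq_sqrt h1.le
    have := hpos s
    generalize √(1 - s^2) = c at *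
    simp only [id]
    field_simp
    have : s^2 = 1 - c^2 := by linarith
    linear_combination (-1) * this

/-- The expected reciprocal of the stopping time τ equals π/2 − 1. -/
theorem expected_inv_tau
{Ω : Type*} [MeasurableSpace Ω] (P : Measure Ω) [IsProbabilityMeasure P]
    (X : ℕ → Ω → ℤ) (hmeas : ∀ i, Measurable (X i))
    (hindep : iIndepFun X P)
    (hheads : ∀ i, P {ω | X i ω = 1} = 1/2)
    (htails : ∀ i, P {ω | X i ω = -1} = 1/2)
    (τ : Ω → ℕ) (hτ : ∀ ω, τ ω = sInf {n | 1 ≤ n ∧ (∑ i ∈ Finset.range n, X i ω) = 1}) :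
    ∫ ω, (1 : ℝ) / (τ ω : ℝ) ∂P = π / 2 - 1 := by
  have τm := tau_meas X hmeas τ hτ
  have e1 : ∀ ω, (1 : ℝ) / (τ ω : ℝ) =
      ∫ s in Set.Ioo (0:ℝ) 1, (if τ ω = 0 then 0 else s ^ (τ ω - 1)) := by
    intro ω
    by_cases h : τ ω = 0
    · simp [h]
    · simp only [h, if_false]
      rw [← integral_Ioc_eq_integral_Ioo, ← intervalIntegral.integral_of_le zero_le_one,
        integral_pow]
      obtain ⟨m, hm⟩ := Nat.exists_eq_succ_of_ne_zero h
      simp [hm]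
  simp only [e1]
  rw [integral_integral_swap]
  · rw [← final_int, intervalIntegral.integral_of_le zero_le_one, integral_Ioc_eq_integral_Ioo]
    refine setIntegral_congr_fun measurableSet_Ioo fun s hs => ?_
    have h1 : 0 < 1 - s^2 := by nlinarith [hs.1, hs.2]
    have hq : 0 < √(1 - s^2) := Real.sqrt_pos.2 h1
    have hsq : √(1 - s^2)^2 = 1 - s^2 := Real.sq_sqrt h1.le
    have hs0 : 0 < s := hs.1
    have g := gen_fun P X hmeas hindep hheads htails τ hτ s (s / (1 + √(1 - s^2))) hs.1 hs.2
      (by positivity) (by rw [div_le_one (by positivity)]; linarith [hs.2])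
      (by
        generalize √(1 - s^2) = c at *
        field_simp
        linear_combination hsq)
    have e2 : ∀ ω, (if τ ω = 0 then 0 else s ^ (τ ω - 1)) =
        s⁻¹ * (if τ ω = 0 then 0 else s ^ (τ ω)) := by
      intro ω
      by_cases h : τ ω = 0
      · simp [h]
      · simp only [h, if_false]
        obtain ⟨m, hm⟩ := Nat.exists_eq_succ_of_ne_zero h
        simp [hm, pow_succ]
        field_simp
    simp only [e2]
    rw [integral_const_mul, g]
    field_simp
  · have hm : Measurable (Function.uncurry fun (ω : Ω) (s : ℝ) =>
        (if τ ω = 0 then 0 else s ^ (τ ω - 1))) := by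
      have m1 : Measurable (fun p : ℕ × ℝ => if p.1 = 0 then (0:ℝ) else p.2 ^ (p.1 - 1)) := by
        refine measurable_from_prod_countable_right fun n => ?_
        by_cases h : n = 0
        · simp [h]
        · simp only [h, if_false]; fun_prop
      exact m1.comp ((τm.comp measurable_fst).prodMk measurable_snd)
    refine Integrable.of_bound hm.aestronglyMeasurable 1 ?_
    have : ∀ᵐ p ∂(P.prod (volume.restrict (Set.Ioo (0:ℝ) 1))), p.2 ∈ Set.Ioo (0:ℝ) 1 :=
      Measure.quasiMeasurePreserving_snd.ae (ae_restrict_mem measurableSet_Ioo)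
    filter_upwards [this] with p hp
    simp only [Function.uncurry]
    split_ifs
    · simp
    · rw [norm_pow, Real.norm_eq_abs, abs_of_pos hp.1]
      exact pow_le_one₀ hp.1.le hp.2.le
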